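/- Let A be a symmetric d-tensor of dimension n over ℂ whose associated multilinear form is nondegenerate, and let Z(A) = {X ∈ ℂ^{n×n} : Xᵀ A^{(i₃⋯i_d)} = A^{(i₃⋯i_d)} X for all i₃,…,i_d}. Then A is diagonalizable (there exists P ∈ GL(n,ℂ) such that the d-congruence AP^d is a diagonal tensor, i.e. its entries vanish unless all indices are equal) if and only if dim Z(A) = n and every matrix in Z(A) is diagonalizable. -/

import Mathlib

open Matrix Function

namespace Stmt15Aux

open Module

/-- Matrices acting diagonally on a given basis form an `n`-dimensional space. -/
lemma exists_diag_submodule {n : ℕ} (b : Basis (Fin n) ℂ (Fin n → ℂ)) :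
    ∃ W : Submodule ℂ (Matrix (Fin n) (Fin n) ℂ), finrank ℂ W = n ∧
      ∀ X, X ∈ W ↔ ∃ d : Fin n → ℂ, ∀ j, X *ᵥ b j = d j • b j := by
  let F : (Fin n → ℂ) →ₗ[ℂ] Matrix (Fin n) (Fin n) ℂ :=
    { toFun := fun d => LinearMap.toMatrix' (b.constr ℂ (fun j => d j • b j))
      map_add' := by
        intro d d'
        rw [← map_add]
        congr 1
        apply b.ext
        intro j
        simp only [Basis.constr_basis, LinearMap.add_apply, Pi.add_apply, add_smul]
      map_smul' := by
        intro c d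
        rw [← map_smul]
        congr 1
        apply b.ext
        intro j
        simp only [Basis.constr_basis, LinearMap.smul_apply, Pi.smul_apply, smul_eq_mul,
          mul_smul, RingHom.id_apply] }
  have hF : ∀ d j, F d *ᵥ b j = d j • b j := by
    intro d j
    change LinearMap.toMatrix' (b.constr ℂ (fun j => d j • b j)) *ᵥ b j = _
    rw [LinearMap.toMatrix'_mulVec]
    simp
  refine ⟨LinearMap.range F, ?_, ?_⟩
  · rw [LinearMap.finrank_range_of_inj]
    · simp
    · intro d d' h
      funext j
      have h1 := hF d j
      rw [h, hF d' j] at h1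
      exact (smul_left_injective ℂ (b.ne_zero j) h1).symm
  · intro X
    constructor
    · rintro ⟨d, rfl⟩
      exact ⟨d, hF d⟩
    · rintro ⟨d, hd⟩
      refine ⟨d, ?_⟩
      apply Matrix.toLin'.injective
      apply b.ext
      intro j
      rw [Matrix.toLin'_apply, Matrix.toLin'_apply, hF, hd]

lemma basis_of_unit {n : ℕ} (Q : Matrix (Fin n) (Fin n) ℂ) (hQ : IsUnit Q) :
    ∃ b : Basis (Fin n) ℂ (Fin n → ℂ), ∀ j i, b j i = Q i j := by
  have hinv : Invertible Q := hQ.invertible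
  refine ⟨(Pi.basisFun ℂ (Fin n)).map (Matrix.toLin'OfInv (invOf_mul_self Q) (mul_invOf_self Q)), ?_⟩
  intro j i
  simp [Matrix.toLin'OfInv]

lemma unit_of_basis {n : ℕ} (b : Basis (Fin n) ℂ (Fin n → ℂ)) :
    IsUnit (Matrix.of fun i j => b j i) := by
  have h : (Matrix.of fun i j => b j i) = (Pi.basisFun ℂ (Fin n)).toMatrix b := by
    ext i j
    simp [Basis.toMatrix_apply]
  rw [h]
  have := (Pi.basisFun ℂ (Fin n)).invertibleToMatrix b
  exact isUnit_of_invertible _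

lemma diag_iff {n : ℕ} (Q X : Matrix (Fin n) (Fin n) ℂ) (hQ : IsUnit Q)
    (b : Basis (Fin n) ℂ (Fin n → ℂ)) (hb : ∀ j i, b j i = Q i j) :
    (Q⁻¹ * X * Q).IsDiag ↔ ∃ d : Fin n → ℂ, ∀ j, X *ᵥ b j = d j • b j := by
  have hdet : IsUnit Q.det := (Matrix.isUnit_iff_isUnit_det Q).1 hQ
  have key : ∀ d : Fin n → ℂ, (∀ j, X *ᵥ b j = d j • b j) ↔ X * Q = Q * diagonal d := by
    intro d
    constructor
    · intro h
      ext i j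
      have := congrFun (h j) i
      simp only [mulVec, dotProduct, hb, Pi.smul_apply, smul_eq_mul] at this
      rw [Matrix.mul_apply, this, Matrix.mul_diagonal, mul_comm]
    · intro h j
      ext i
      have := congrFun (congrFun h i) j
      rw [Matrix.mul_apply, Matrix.mul_diagonal] at this
      simp only [mulVec, dotProduct, hb, Pi.smul_apply, smul_eq_mul]
      rw [this, mul_comm]
  constructor
  · intro h
    refine ⟨(Q⁻¹ * X * Q).diag, (key _).2 ?_⟩
    rw [h.diagonal_diag, mul_assoc, Matrix.mul_nonsing_inv_cancel_left _ _ hdet]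
  · rintro ⟨d, hd⟩
    rw [key] at hd
    rw [mul_assoc, hd, Matrix.nonsing_inv_mul_cancel_left _ _ hdet]
    exact Matrix.isDiag_diagonal d

lemma eigen_of_gen {n : ℕ} (b : Basis (Fin n) ℂ (Fin n → ℂ)) (f : End ℂ (Fin n → ℂ))
    (d : Fin n → ℂ) (hd : ∀ j, f (b j) = d j • b j) (μ : ℂ) (v : Fin n → ℂ)
    (hv : v ∈ f.maxGenEigenspace μ) : f v = μ • v := by
  have h1 : ∀ w i, b.repr ((f - μ • (1 : End ℂ (Fin n → ℂ))) w) i = (d i - μ) * b.repr w i := by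
    intro w i
    have : (b.coord i) ∘ₗ (f - μ • (1 : End ℂ (Fin n → ℂ))) = (d i - μ) • b.coord i := by
      apply b.ext
      intro j
      by_cases hij : j = i
      · subst hij; simp [hd]
      · simp [hd, hij]
    simpa using LinearMap.congr_fun this w
  have h2 : ∀ (k : ℕ) w i, b.repr (((f - μ • (1 : End ℂ (Fin n → ℂ))) ^ k) w) i
      = (d i - μ) ^ k * b.repr w i := by
    intro k
    induction k with
    | zero => intro w i; simp
    | succ k ih =>
      intro w i
      rw [pow_succ, Module.End.mul_apply, ih, h1, pow_succ, mul_assoc]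
  rw [Module.End.mem_maxGenEigenspace] at hv
  obtain ⟨k, hk⟩ := hv
  have h3 : (f - μ • (1 : End ℂ (Fin n → ℂ))) v = 0 := by
    apply b.repr.injective
    ext i
    rw [h1]
    have := h2 k v i
    rw [hk] at this
    simp only [map_zero, Finsupp.coe_zero, Pi.zero_apply] at this ⊢
    rcases mul_eq_zero.1 this.symm with h | h
    · rw [eq_zero_of_pow_eq_zero h, zero_mul]
    · rw [h, mul_zero]
  simpa [sub_eq_zero] using h3

lemma simult {n : ℕ} (Z : Submodule ℂ (Matrix (Fin n) (Fin n) ℂ))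
    (hc : ∀ X ∈ Z, ∀ Y ∈ Z, X * Y = Y * X)
    (hd : ∀ X ∈ Z, ∃ Q : Matrix (Fin n) (Fin n) ℂ, IsUnit Q ∧ (Q⁻¹ * X * Q).IsDiag) :
    ∃ b : Basis (Fin n) ℂ (Fin n → ℂ), ∀ X ∈ Z, ∃ d : Fin n → ℂ, ∀ j, X *ᵥ b j = d j • b j := by
  let f : Z → End ℂ (Fin n → ℂ) := fun X => Matrix.toLin' X.1
  have htop := Module.End.iSup_iInf_maxGenEigenspace_eq_top_of_iSup_maxGenEigenspace_eq_top_of_commute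
    f (by
      intro X Y _
      change Matrix.toLin' X.1 * Matrix.toLin' Y.1 = Matrix.toLin' Y.1 * Matrix.toLin' X.1
      rw [Module.End.mul_eq_comp, Module.End.mul_eq_comp, ← Matrix.toLin'_mul, ← Matrix.toLin'_mul,
        hc _ X.2 _ Y.2])
    (fun X => Module.End.iSup_maxGenEigenspace_eq_top (f X))
  let s : Set (Fin n → ℂ) := {v | ∀ X ∈ Z, ∃ μ : ℂ, X *ᵥ v = μ • v}
  have hs : ⊤ ≤ Submodule.span ℂ s := by
    rw [← htop]
    refine iSup_le fun χ v hv => Submodule.subset_span ?_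
    intro X hX
    refine ⟨χ ⟨X, hX⟩, ?_⟩
    rw [Submodule.mem_iInf] at hv
    obtain ⟨Q, hQ, hQX⟩ := hd X hX
    obtain ⟨b, hb⟩ := basis_of_unit Q hQ
    obtain ⟨d, hd'⟩ := (diag_iff Q X hQ b hb).1 hQX
    exact eigen_of_gen b (f ⟨X, hX⟩) d hd' _ v (hv ⟨X, hX⟩)
  let b0 := Basis.ofSpan hs
  have hb0 : ∀ i, b0 i ∈ s := fun i => Basis.ofSpan_subset hs ⟨i, rfl⟩
  let eqv := b0.indexEquiv (Pi.basisFun ℂ (Fin n))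
  refine ⟨b0.reindex eqv, ?_⟩
  intro X hX
  choose d hd' using fun i => hb0 i X hX
  refine ⟨fun j => d (eqv.symm j), fun j => ?_⟩
  rw [Basis.reindex_apply]
  exact hd' _

abbrev ML (n k : ℕ) := MultilinearMap ℂ (fun _ : Fin k => (Fin n → ℂ)) ℂ

/-- The multilinear form attached to a tensor. -/
noncomputable def form {n k : ℕ} (A : (Fin k → Fin n) → ℂ) : ML n k :=
  ∑ idx : Fin k → Fin n, A idx •
    (MultilinearMap.mkPiAlgebra ℂ (Fin k) ℂ).compLinearMap (fun t => LinearMap.proj (idx t))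

lemma form_apply {n k : ℕ} (A : (Fin k → Fin n) → ℂ) (m : Fin k → Fin n → ℂ) :
    form A m = ∑ idx : Fin k → Fin n, A idx * ∏ t, m t (idx t) := by
  simp [form]

lemma form_basis {n k : ℕ} (A : (Fin k → Fin n) → ℂ) (idx : Fin k → Fin n) :
    form A (fun t => Pi.single (idx t) 1) = A idx := by
  rw [form_apply, Finset.sum_eq_single idx]
  · simp
  · intro j _ hj
    obtain ⟨t, ht⟩ := Function.ne_iff.1 hj
    rw [Finset.prod_eq_zero (Finset.mem_univ t), mul_zero]
    simp [ht]
  · simp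

lemma form_symm {n k : ℕ} (A : (Fin k → Fin n) → ℂ)
    (hA : ∀ (σ : Equiv.Perm (Fin k)) (idx : Fin k → Fin n), A (idx ∘ σ) = A idx)
    (σ : Equiv.Perm (Fin k)) (m : Fin k → Fin n → ℂ) : form A (m ∘ σ) = form A m := by
  rw [form_apply, form_apply]
  rw [← (Equiv.arrowCongr σ.symm (Equiv.refl (Fin n))).sum_comp]
  refine Finset.sum_congr rfl fun idx _ => ?_
  have h1 : (Equiv.arrowCongr σ.symm (Equiv.refl (Fin n))) idx = idx ∘ σ := by
    ext; simp
  rw [h1, hA]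
  congr 1
  exact Equiv.prod_comp σ (fun t => m t (idx t))

/-- Expansion of one slot in a basis. -/
lemma expand {n k : ℕ} (Θ : ML n k) (b : Basis (Fin n) ℂ (Fin n → ℂ)) (m : Fin k → Fin n → ℂ)
    (s : Fin k) (u : Fin n → ℂ) :
    Θ (update m s u) = ∑ i, b.repr u i * Θ (update m s (b i)) := by
  conv_lhs => rw [← b.sum_repr u]
  rw [MultilinearMap.map_update_sum]
  simp

lemma move_ext {n k : ℕ} (Θ : ML n k) (b : Basis (Fin n) ℂ (Fin n → ℂ))
    (X : Matrix (Fin n) (Fin n) ℂ) (s t : Fin k)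
    (h : ∀ idx : Fin k → Fin n, Θ (update (fun r => b (idx r)) s (X *ᵥ b (idx s)))
      = Θ (update (fun r => b (idx r)) t (X *ᵥ b (idx t)))) (m : Fin k → Fin n → ℂ) :
    Θ (update m s (X *ᵥ m s)) = Θ (update m t (X *ᵥ m t)) := by
  let T : Fin k → ML n k := fun s =>
    Θ.compLinearMap (fun r => if r = s then Matrix.toLin' X else LinearMap.id)
  have hT : ∀ s m, T s m = Θ (update m s (X *ᵥ m s)) := by
    intro s m
    change Θ _ = _
    congr 1
    ext r : 1
    by_cases hr : r = s
    · subst hr; simp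
    · simp [hr]
  rw [← hT, ← hT]
  congr 1
  apply Basis.ext_multilinear (fun _ => b)
  intro v
  rw [hT, hT]
  exact h v

def Moves {n k : ℕ} (Θ : ML n k) (X : Matrix (Fin n) (Fin n) ℂ) : Prop :=
  ∀ s t m, Θ (update m s (X *ᵥ m s)) = Θ (update m t (X *ᵥ m t))

lemma moves_of {n k : ℕ} (Θ : ML n (k + 2)) (X : Matrix (Fin n) (Fin n) ℂ)
    (hs : ∀ (σ : Equiv.Perm (Fin (k + 2))) m, Θ (m ∘ σ) = Θ m)
    (h : ∀ m, Θ (update m 0 (X *ᵥ m 0)) = Θ (update m 1 (X *ᵥ m 1))) : Moves Θ X := by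
  have hperm : ∀ (σ : Equiv.Perm (Fin (k + 2))) r m,
      Θ (update (m ∘ σ) r (X *ᵥ (m ∘ σ) r)) = Θ (update m (σ r) (X *ᵥ m (σ r))) := by
    intro σ r m
    rw [← hs σ (update m (σ r) (X *ᵥ m (σ r)))]
    congr 1
    ext q : 1
    by_cases hq : q = r
    · subst hq; simp
    · simp [hq]
  intro s t m
  by_cases hst : s = t
  · rw [hst]
  obtain ⟨σ, h0, h1⟩ : ∃ σ : Equiv.Perm (Fin (k + 2)), σ 0 = s ∧ σ 1 = t := by
    let τ : Equiv.Perm (Fin (k + 2)) := Equiv.swap 0 s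
    refine ⟨(Equiv.swap (1 : Fin (k + 2)) (τ.symm t)).trans τ, ?_, ?_⟩
    · have h2 : (0 : Fin (k + 2)) ≠ τ.symm t := by
        intro h
        apply hst
        rw [Equiv.eq_symm_apply] at h
        simpa [τ] using h
      rw [Equiv.trans_apply, Equiv.swap_apply_of_ne_of_ne (by simp) h2]
      simp [τ]
    · simp
  have := h (m ∘ σ)
  rw [hperm, hperm, h0, h1] at this
  exact this

lemma mem_iff_moves {n e : ℕ} (A : (Fin (e + 2) → Fin n) → ℂ)
    (hA : ∀ (σ : Equiv.Perm (Fin (e + 2))) (idx : Fin (e + 2) → Fin n), A (idx ∘ σ) = A idx)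
    (X : Matrix (Fin n) (Fin n) ℂ) :
    (∀ c : Fin e → Fin n,
        Xᵀ * Matrix.of (fun i j => A (Fin.cons i (Fin.cons j c)))
          = Matrix.of (fun i j => A (Fin.cons i (Fin.cons j c))) * X) ↔ Moves (form A) X := by
  have h : ∀ (s : Fin (e + 2)) (idx : Fin (e + 2) → Fin n),
      form A (update (fun r => Pi.basisFun ℂ (Fin n) (idx r)) s
        (X *ᵥ Pi.basisFun ℂ (Fin n) (idx s))) = ∑ i, X i (idx s) * A (update idx s i) := by
    intro s idx
    rw [expand _ (Pi.basisFun ℂ (Fin n))]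
    refine Finset.sum_congr rfl fun i _ => ?_
    rw [← form_basis A]
    congr 1
    · simp
    · congr 1
      ext r : 1
      by_cases hr : r = s
      · subst hr; simp
      · simp [hr]
  have h0 : ∀ (i j k : Fin n) (c : Fin e → Fin n),
      update (Fin.cons i (Fin.cons j c) : Fin (e + 2) → Fin n) 0 k = Fin.cons k (Fin.cons j c) := by
    intro i j k c
    simp
  have h1 : ∀ (i j k : Fin n) (c : Fin e → Fin n),
      update (Fin.cons i (Fin.cons j c) : Fin (e + 2) → Fin n) 1 k = Fin.cons i (Fin.cons k c) := by
    intro i j k c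
    rw [← Fin.succ_zero_eq_one, ← Fin.cons_update, Fin.update_cons_zero]
  constructor
  · intro H
    apply moves_of _ _ (form_symm A hA)
    apply move_ext _ (Pi.basisFun ℂ (Fin n))
    intro idx
    rw [h, h]
    obtain ⟨i, j, c, rfl⟩ : ∃ i j c, idx = Fin.cons i (Fin.cons j c) :=
      ⟨idx 0, idx 1, fun r => idx r.succ.succ, by
        ext r
        refine Fin.cases ?_ (fun r => ?_) r
        · simp
        · refine Fin.cases ?_ (fun r => ?_) r <;> simp⟩
    have := congrFun (congrFun (H c) i) j
    simp only [Matrix.mul_apply, Matrix.transpose_apply, Matrix.of_apply] at this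
    simp only [h0, h1]
    refine Eq.trans this ?_
    refine Finset.sum_congr rfl fun k _ => ?_
    rw [mul_comm]
    rfl
  · intro H c
    ext i j
    have := H 0 1 (fun r => Pi.basisFun ℂ (Fin n)
      ((Fin.cons i (Fin.cons j c) : Fin (e + 2) → Fin n) r))
    rw [h, h] at this
    simp only [h0, h1] at this
    simp only [Matrix.mul_apply, Matrix.transpose_apply, Matrix.of_apply]
    refine Eq.trans this ?_
    refine Finset.sum_congr rfl fun k _ => ?_
    rw [mul_comm]
    rfl

lemma nondeg {n k : ℕ} (A : (Fin (k + 1) → Fin n) → ℂ)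
    (hnd : ∀ u : Fin n → ℂ,
      (∀ jdx : Fin k → Fin n, (∑ i, u i * A (Fin.cons i jdx)) = 0) → u = 0)
    (u : Fin n → ℂ) (hu : ∀ m, form A (Fin.cons u m) = 0) : u = 0 := by
  apply hnd
  intro jdx
  have h := hu (fun r => Pi.single (jdx r) 1)
  have h2 : (Fin.cons u (fun r => Pi.single (jdx r) 1) : Fin (k + 1) → Fin n → ℂ)
      = update (Fin.cons u (fun r => Pi.single (jdx r) 1)) 0 u := by simp
  rw [h2, expand _ (Pi.basisFun ℂ (Fin n))] at h
  rw [← h]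
  refine Finset.sum_congr rfl fun i _ => ?_
  rw [← form_basis A]
  congr 1
  congr 1
  ext r : 1
  refine Fin.cases ?_ (fun r => ?_) r <;> simp

lemma comm_of_moves {n k : ℕ} (Θ : ML n (k + 3))
    (hnd : ∀ u : Fin n → ℂ, (∀ m, Θ (Fin.cons u m) = 0) → u = 0)
    (X Y : Matrix (Fin n) (Fin n) ℂ) (hX : Moves Θ X) (hY : Moves Θ Y) : X * Y = Y * X := by
  have h01 : (0 : Fin (k + 3)) ≠ 1 := by simp
  have h02 : (0 : Fin (k + 3)) ≠ 2 := by
    intro h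
    have h' := congrArg Fin.val h
    have h2 : 2 % (k + 3) = 2 := Nat.mod_eq_of_lt (by omega)
    simp [h2] at h'
  have h12 : (1 : Fin (k + 3)) ≠ 2 := by
    intro h
    have h' := congrArg Fin.val h
    have h2 : 2 % (k + 3) = 2 := Nat.mod_eq_of_lt (by omega)
    simp [h2] at h'
  have key : ∀ M : Fin (k + 3) → Fin n → ℂ,
      Θ (update M 0 (X *ᵥ (Y *ᵥ M 0))) = Θ (update M 0 (Y *ᵥ (X *ᵥ M 0))) := by
    intro M
    have e1 := hX 0 1 (update M 0 (Y *ᵥ M 0))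
    have e2 := hY 0 2 (update M 1 (X *ᵥ M 1))
    have e3 := hX 1 0 (update M 2 (Y *ᵥ M 2))
    have e4 := hY 2 0 (update M 0 (X *ᵥ M 0))
    simp only [update_idem, update_self, update_of_ne h01, update_of_ne h02, update_of_ne h12,
      update_of_ne h01.symm, update_of_ne h02.symm, update_of_ne h12.symm] at e1 e2 e3 e4
    rw [e1, update_comm h01, e2, update_comm h12, e3, update_comm h02.symm, e4]
  apply Matrix.toLin'.injective
  apply LinearMap.ext
  intro v
  rw [← sub_eq_zero]
  apply hnd
  intro m
  have h := key (Fin.cons v m)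
  simp only [Fin.update_cons_zero, Fin.cons_zero] at h
  have h3 := Θ.map_update_sub (Fin.cons v m) 0 (X *ᵥ (Y *ᵥ v)) (Y *ᵥ (X *ᵥ v))
  simp only [Fin.update_cons_zero] at h3
  rw [h, sub_self] at h3
  simpa using h3

lemma moves_iff_diag {n k : ℕ} (Θ : ML n (k + 3))
    (hnd : ∀ u : Fin n → ℂ, (∀ m, Θ (Fin.cons u m) = 0) → u = 0)
    (b : Basis (Fin n) ℂ (Fin n → ℂ))
    (hb : ∀ j : Fin (k + 3) → Fin n, (¬ ∀ s s', j s = j s') → Θ (fun t => b (j t)) = 0)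
    (X : Matrix (Fin n) (Fin n) ℂ) :
    Moves Θ X ↔ ∃ d : Fin n → ℂ, ∀ j, X *ᵥ b j = d j • b j := by
  have hupd : ∀ (j : Fin (k + 3) → Fin n) s i,
      update (fun t => b (j t)) s (b i) = fun t => b (update j s i t) := by
    intro j s i
    ext t : 1
    by_cases ht : t = s
    · subst ht; simp
    · simp [ht]
  have h01 : (0 : Fin (k + 3)) ≠ 1 := by simp
  have h02 : (0 : Fin (k + 3)) ≠ 2 := by
    intro h
    have h' := congrArg Fin.val h
    have h2 : 2 % (k + 3) = 2 := Nat.mod_eq_of_lt (by omega)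
    simp [h2] at h'
  have h12 : (1 : Fin (k + 3)) ≠ 2 := by
    intro h
    have h' := congrArg Fin.val h
    have h2 : 2 % (k + 3) = 2 := Nat.mod_eq_of_lt (by omega)
    simp [h2] at h'
  constructor
  · intro H
    refine ⟨fun j => b.repr (X *ᵥ b j) j, fun i => ?_⟩
    apply b.repr.injective
    ext j
    by_cases hij : i = j
    · subst hij; simp
    have hl : Θ (fun _ => b j) ≠ 0 := by
      intro h0
      apply b.ne_zero j
      apply hnd
      have : Θ.curryLeft (b j) = 0 := by
        apply Basis.ext_multilinear (fun _ => b)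
        intro v
        rw [MultilinearMap.curryLeft_apply]
        have h5 : (Fin.cons (b j) (fun i => b (v i)) : Fin (k + 3) → Fin n → ℂ)
            = fun t => b ((Fin.cons j v : Fin (k + 3) → Fin n) t) := by
          ext r : 1
          refine Fin.cases ?_ (fun r => ?_) r <;> simp
        rw [h5]
        by_cases hc : ∀ s s', (Fin.cons j v : Fin (k + 3) → Fin n) s
            = (Fin.cons j v : Fin (k + 3) → Fin n) s'
        · have h6 : (fun t => b ((Fin.cons j v : Fin (k + 3) → Fin n) t)) = fun _ => b j := by
            ext t : 1
            rw [hc t 0, Fin.cons_zero]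
          rw [h6, h0]
          rfl
        · rw [hb _ hc]
          rfl
      intro m
      exact congrArg (fun T => T m) this
    have h1 := H 0 1 (fun t => b (update (fun _ => j) 0 i t))
    rw [expand Θ b, expand Θ b, Finset.sum_eq_single j, Finset.sum_eq_zero] at h1
    · simp only [hupd, update_idem, update_self] at h1
      have h7 : (fun t : Fin (k + 3) => b (update (fun _ => j) 0 j t)) = fun _ => b j := by
        ext t : 1
        by_cases ht : t = 0
        · subst ht; simp
        · simp [ht]
      rw [h7] at h1
      rcases mul_eq_zero.1 h1 with h | h
      · rw [h]; simp [hij]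
      · exact absurd h hl
    · intro r _
      rw [hupd, hb, mul_zero]
      intro hc
      have := hc 0 2
      rw [update_of_ne h01, update_of_ne h12.symm, update_self, update_of_ne h02.symm] at this
      exact hij this
    · intro r _ hr
      rw [hupd, hb, mul_zero]
      intro hc
      have := hc 0 1
      rw [update_self, update_of_ne h01.symm, update_of_ne h01.symm] at this
      exact hr this
    · simp
  · rintro ⟨d, hd⟩ s t
    apply move_ext Θ b
    intro idx
    rw [hd, hd, MultilinearMap.map_update_smul, MultilinearMap.map_update_smul, hupd, hupd,
      update_eq_self, update_eq_self]
    by_cases hc : ∀ s s', idx s = idx s'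
    · rw [hc s t]
    · rw [hb _ hc, smul_zero, smul_zero]

end Stmt15Aux


/-- Let `A` be a symmetric `d`-tensor (here `d = e + 2 ≥ 3`) of dimension `n`
over `ℂ` whose associated multilinear form is nondegenerate, and `Z(A)` its center. Then `A`
is diagonalizable (there is `P ∈ GL(n,ℂ)` with `AP^d` diagonal) iff `dim Z(A) = n` and
every matrix in `Z(A)` is diagonalizable. -/
theorem stmt_15 {n e : ℕ} (he : 1 ≤ e)
    (A : (Fin (e + 2) → Fin n) → ℂ)
    (hA : ∀ (σ : Equiv.Perm (Fin (e + 2))) (idx : Fin (e + 2) → Fin n), A (idx ∘ σ) = A idx)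
    (hnd : ∀ u : Fin n → ℂ,
      (∀ jdx : Fin (e + 1) → Fin n, (∑ i, u i * A (Fin.cons i jdx)) = 0) → u = 0)
    (Z : Submodule ℂ (Matrix (Fin n) (Fin n) ℂ))
    (hZ : ∀ X : Matrix (Fin n) (Fin n) ℂ, X ∈ Z ↔
      ∀ c : Fin e → Fin n,
        Xᵀ * Matrix.of (fun i j => A (Fin.cons i (Fin.cons j c)))
          = Matrix.of (fun i j => A (Fin.cons i (Fin.cons j c))) * X) :
    (∃ P : Matrix (Fin n) (Fin n) ℂ, IsUnit P ∧
        ∀ jdx : Fin (e + 2) → Fin n, (¬ ∀ s s' : Fin (e + 2), jdx s = jdx s') →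
          (∑ idx : Fin (e + 2) → Fin n, A idx * ∏ t, P (idx t) (jdx t)) = 0)
      ↔ (Module.finrank ℂ ↥Z = n ∧
          ∀ X ∈ Z, ∃ Q : Matrix (Fin n) (Fin n) ℂ, IsUnit Q ∧ (Q⁻¹ * X * Q).IsDiag) := by
  obtain ⟨k, rfl⟩ : ∃ k, e = k + 1 := ⟨e - 1, by omega⟩
  have hZ' : ∀ X, X ∈ Z ↔ Stmt15Aux.Moves (Stmt15Aux.form A) X := fun X =>
    (hZ X).trans (Stmt15Aux.mem_iff_moves A hA X)
  have hnd' := Stmt15Aux.nondeg A hnd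
  constructor
  · rintro ⟨P, hP, hdiag⟩
    obtain ⟨b, hb⟩ := Stmt15Aux.basis_of_unit P hP
    have hbd : ∀ j : Fin (k + 3) → Fin n, (¬ ∀ s s', j s = j s') →
        Stmt15Aux.form A (fun t => b (j t)) = 0 := by
      intro j hj
      rw [Stmt15Aux.form_apply]
      simpa only [hb] using hdiag j hj
    have hm := Stmt15Aux.moves_iff_diag (Stmt15Aux.form A) hnd' b hbd
    obtain ⟨W, hW, hWm⟩ := Stmt15Aux.exists_diag_submodule b
    have hZW : Z = W := by
      ext X
      rw [hZ', hWm, hm]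
    refine ⟨by rw [hZW, hW], fun X hX => ⟨P, hP, ?_⟩⟩
    rw [Stmt15Aux.diag_iff P X hP b hb, ← hm, ← hZ']
    exact hX
  · rintro ⟨hdim, hdz⟩
    obtain ⟨b, hb⟩ := Stmt15Aux.simult Z (fun X hX Y hY =>
      Stmt15Aux.comm_of_moves (Stmt15Aux.form A) hnd' X Y ((hZ' X).1 hX) ((hZ' Y).1 hY)) hdz
    obtain ⟨W, hW, hWm⟩ := Stmt15Aux.exists_diag_submodule b
    have hZW : Z = W := Submodule.eq_of_le_of_finrank_eq
      (fun X hX => (hWm X).2 (hb X hX)) (by rw [hdim, hW])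
    refine ⟨Matrix.of fun i j => b j i, Stmt15Aux.unit_of_basis b, ?_⟩
    intro j hj
    have hgoal : Stmt15Aux.form A (fun t => b (j t)) = 0 := by
      push Not at hj
      obtain ⟨s, s', hss⟩ := hj
      obtain ⟨X, hX⟩ : ∃ X : Matrix (Fin n) (Fin n) ℂ, ∀ i,
          X *ᵥ b i = (if i = j s then (1 : ℂ) else 0) • b i := by
        refine ⟨LinearMap.toMatrix' (b.constr ℂ
          (fun i => (if i = j s then (1 : ℂ) else 0) • b i)), fun i => ?_⟩
        rw [LinearMap.toMatrix'_mulVec, Module.Basis.constr_basis]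
      have hXZ : X ∈ Z := by
        rw [hZW, hWm]
        exact ⟨_, hX⟩
      have h := (hZ' X).1 hXZ s s' (fun t => b (j t))
      rw [hX, hX, if_pos rfl, if_neg (Ne.symm hss), one_smul, zero_smul,
        MultilinearMap.map_update_zero, Function.update_eq_self] at h
      exact h
    rw [Stmt15Aux.form_apply] at hgoal
    exact hgoal
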